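/- Explicit annulus SLE partition function for κ = 1 (excursion-reflected case): for r > 0 and x ∈ (0,2π), the function Z(r,x) := Θ′(r,0)² · Θ(r,x)^{−2} · ( 4 H(r,x)³ − 6 H(r,x) H′(r,x) + H″(r,x) + 12·(ζ_r(π)/π)·H(r,x) ) satisfies the null-vector equation ∂_r Z = (1/2)·∂_x² Z + H(r,x)·∂_x Z + (5/2)·H′(r,x)·Z − 6·(ζ_r(π)/π)·Z (this is the equation ∂_r Z = (κ/2)Z″ + H Z′ + (3/κ − 1/2)H′ Z − (6/κ)(ζ_r(π)/π) Z with κ = 1). -/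

import Mathlib

open Complex

/-- The theta function Θ(r,z) = (1/i)·∑_{n∈ℤ} (−1)^n e^{−r(n+1/2)²} e^{(n+1/2)iz}. -/
noncomputable def Theta (r : ℝ) (z : ℂ) : ℂ :=
  (1 / Complex.I) * ∑' n : ℤ, (-1 : ℂ) ^ n *
    Complex.exp (-(r : ℂ) * ((n : ℂ) + 1 / 2) ^ 2) *
    Complex.exp (((n : ℂ) + 1 / 2) * Complex.I * z)

/-- The Loewner kernel H(r,z) = 2 Θ′(r,z)/Θ(r,z). -/
noncomputable def Hker (r : ℝ) (z : ℂ) : ℂ := 2 * deriv (Theta r) z / Theta r z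

/-- The lattice L_r = 2πℤ + 2irℤ. -/
def ThetaLattice (r : ℝ) : Set ℂ :=
  {z | ∃ m n : ℤ, z = 2 * (Real.pi : ℂ) * m + 2 * Complex.I * r * n}

/-- Lattice point 2πm + 2irn. -/
noncomputable def latPt (r : ℝ) (p : ℤ × ℤ) : ℂ :=
  2 * (Real.pi : ℂ) * p.1 + 2 * Complex.I * (r : ℂ) * p.2

/-- The Weierstrass zeta function with periods (2π, 2ir). -/
noncomputable def wzeta (r : ℝ) (z : ℂ) : ℂ :=
  1 / z + ∑' p : ℤ × ℤ, if p = 0 then 0 else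
    (1 / (z - latPt r p) + 1 / latPt r p + z / latPt r p ^ 2)

/-- The explicit annulus SLE partition function for κ = 1 (ER case):
Z(r,x) = Θ′(r,0)²·Θ(r,x)^{−2}·(4H³ − 6HH′ + H″ + 12(ζ_r(π)/π)H). -/
noncomputable def Zone (r x : ℝ) : ℝ :=
  (deriv (Theta r) 0).re ^ 2 / (Theta r (x : ℂ)).re ^ 2 *
  (4 * (Hker r (x : ℂ)).re ^ 3 -
   6 * (Hker r (x : ℂ)).re * (deriv (Hker r) (x : ℂ)).re +
   (deriv (deriv (Hker r)) (x : ℂ)).re +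
   12 * ((wzeta r (Real.pi : ℂ)).re / Real.pi) * (Hker r (x : ℂ)).re)

noncomputable def tt (k : ℕ) (r : ℝ) (n : ℤ) (z : ℂ) : ℂ :=
  (I * ((n : ℂ) + 1 / 2)) ^ k * ((-1 : ℂ) ^ n *
    Complex.exp (-(r : ℂ) * ((n : ℂ) + 1 / 2) ^ 2) *
    Complex.exp (((n : ℂ) + 1 / 2) * Complex.I * z))

noncomputable def TT (k : ℕ) (r : ℝ) (z : ℂ) : ℂ := (1 / I) * ∑' n : ℤ, tt k r n z

lemma TT_zero (r : ℝ) : TT 0 r = Theta r := by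
  funext z; simp [TT, tt, Theta]

noncomputable def tbd (k : ℕ) (a S : ℝ) (n : ℤ) : ℝ :=
  Real.exp S * Real.exp (-a * n ^ 2 + (k + a + S) * |(n : ℝ)|)

lemma summable_tbd (k : ℕ) {a : ℝ} (ha : 0 < a) (S : ℝ) : Summable (tbd k a S) := by
  have h := summable_pow_mul_jacobiTheta₂_term_bound ((k + a + S) / (2 * Real.pi))
    (T := a / Real.pi) (by positivity) 0
  unfold tbd
  refine Summable.mul_left _ (h.congr fun n => ?_)
  simp only [pow_zero, one_mul]
  congr 1
  have := Real.pi_ne_zero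
  push_cast
  field_simp
  ring

lemma norm_tt_le (k : ℕ) {a S r : ℝ} (ha : 0 < a) (har : a ≤ r) {z : ℂ} (hz : |z.im| ≤ S)
    (n : ℤ) : ‖tt k r n z‖ ≤ tbd k a S n := by
  have e1 : ((n : ℂ) + 1 / 2) = ((n + 1 / 2 : ℝ) : ℂ) := by push_cast; rfl
  have hS : 0 ≤ S := (abs_nonneg _).trans hz
  have habs : |(n : ℝ) + 1 / 2| ≤ |(n : ℝ)| + 1 := by
    refine (abs_add_le _ _).trans ?_
    norm_num [abs_of_pos]
  have h1 : ‖(I * ((n : ℂ) + 1 / 2)) ^ k‖ ≤ Real.exp (k * |(n : ℝ)|) := by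
    rw [norm_pow, norm_mul, norm_I, one_mul, e1, norm_real, Real.norm_eq_abs, Real.exp_nat_mul]
    gcongr
    exact habs.trans (Real.add_one_le_exp _)
  have h2 : ‖Complex.exp (-(r : ℂ) * ((n : ℂ) + 1 / 2) ^ 2)‖
      ≤ Real.exp (-a * n ^ 2 + a * |(n : ℝ)|) := by
    rw [e1, norm_exp]
    have : (-(r : ℂ) * ((n + 1 / 2 : ℝ) : ℂ) ^ 2).re = - r * (n + 1 / 2) ^ 2 := by
      norm_cast
    rw [this]
    gcongr
    have h3 : (n : ℝ) ^ 2 - |(n : ℝ)| ≤ (n + 1 / 2) ^ 2 := by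
      nlinarith [neg_abs_le (n : ℝ)]
    nlinarith [sq_nonneg ((n : ℝ) + 1 / 2)]
  have h3 : ‖Complex.exp (((n : ℂ) + 1 / 2) * Complex.I * z)‖ ≤
      Real.exp (S + S * |(n : ℝ)|) := by
    rw [e1, norm_exp]
    have : (((n + 1 / 2 : ℝ) : ℂ) * Complex.I * z).re = - ((n + 1 / 2) * z.im) := by
      rw [mul_assoc, re_ofReal_mul]; simp
    rw [this]
    gcongr
    refine (neg_le_abs _).trans ?_
    rw [abs_mul]
    calc _ ≤ (|(n : ℝ)| + 1) * S := by gcongr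
      _ = _ := by ring
  unfold tt tbd
  rw [norm_mul, norm_mul, norm_mul, norm_zpow, norm_neg, norm_one, one_zpow, one_mul]
  calc _ ≤ Real.exp (k * |(n : ℝ)|) * (Real.exp (-a * n ^ 2 + a * |(n : ℝ)|) *
        Real.exp (S + S * |(n : ℝ)|)) := by gcongr
    _ = _ := by rw [← Real.exp_add, ← Real.exp_add, ← Real.exp_add]; congr 1; ring

lemma summable_tt (k : ℕ) {r : ℝ} (hr : 0 < r) (z : ℂ) : Summable fun n => tt k r n z :=
  .of_norm_bounded (summable_tbd k hr |z.im|) fun n => norm_tt_le k hr le_rfl le_rfl n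

lemma hasDerivAt_TT (k : ℕ) {r : ℝ} (hr : 0 < r) (z : ℂ) :
    HasDerivAt (TT k r) (TT (k + 1) r z) z := by
  unfold TT
  refine HasDerivAt.const_mul _ ?_
  have hopen : IsOpen {w : ℂ | |w.im| < |z.im| + 1} :=
    isOpen_lt (by fun_prop) (by fun_prop)
  have hconv : Convex ℝ {w : ℂ | |w.im| < |z.im| + 1} := by
    have : {w : ℂ | |w.im| < |z.im| + 1} = imCLM ⁻¹' (Metric.ball 0 (|z.im| + 1)) := by
      ext w; simp
    rw [this]
    exact (convex_ball _ _).is_linear_preimage imLm.isLinear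
  refine hasDerivAt_tsum_of_isPreconnected (t := {w : ℂ | |w.im| < |z.im| + 1}) (y₀ := z)
    (summable_tbd (k + 1) hr (|z.im| + 1))
    hopen hconv.isPreconnected (fun n y _ => ?_) (fun n y hy => ?_) ?_ (summable_tt k hr z) ?_
  · unfold tt
    have h : HasDerivAt (fun w : ℂ => ((n : ℂ) + 1 / 2) * Complex.I * w)
      (((n : ℂ) + 1 / 2) * Complex.I) y := by
      simpa using (hasDerivAt_id y).const_mul (((n : ℂ) + 1 / 2) * Complex.I)
    refine ((h.cexp.const_mul _).const_mul _).congr_deriv ?_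
    ring
  · exact norm_tt_le _ hr le_rfl (le_of_lt hy) n
  · simp
  · simp

lemma hasDerivAt_TT_r (k : ℕ) {r : ℝ} (hr : 0 < r) (z : ℂ) :
    HasDerivAt (fun s => TT k s z) (TT (k + 2) r z) r := by
  unfold TT
  refine HasDerivAt.const_mul _ ?_
  refine hasDerivAt_tsum_of_isPreconnected (t := Set.Ioi (r / 2)) (y₀ := r)
    (g := fun n s => tt k s n z) (g' := fun n s => tt (k + 2) s n z)
    (summable_tbd (k + 2) (half_pos hr) (|z.im|))
    isOpen_Ioi isPreconnected_Ioi (fun n y _ => ?_) (fun n y hy => ?_) ?_ (summable_tt k hr z) ?_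
  · unfold tt
    have h : HasDerivAt (fun w : ℝ => -(w : ℂ) * ((n : ℂ) + 1 / 2) ^ 2)
      (-((n : ℂ) + 1 / 2) ^ 2) y := by
      have h0 : HasDerivAt (fun w : ℝ => (w : ℂ)) 1 y := by
        simpa using (hasDerivAt_id y).ofReal_comp
      refine (h0.neg.mul_const (((n : ℂ) + 1 / 2) ^ 2)).congr_deriv ?_
      ring
    refine (((h.cexp.const_mul _).mul_const _).const_mul _).congr_deriv ?_
    rw [pow_add, mul_pow I _ 2, I_sq]
    ring
  · exact norm_tt_le _ (half_pos hr) (le_of_lt hy) le_rfl n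
  · simpa using hr
  · simpa using hr

lemma TT_add_two_pi (k : ℕ) (r : ℝ) (z : ℂ) : TT k r (z + 2 * Real.pi) = - TT k r z := by
  unfold TT
  rw [← mul_neg, ← tsum_neg]
  congr 1
  refine tsum_congr fun n => ?_
  unfold tt
  have : ((n : ℂ) + 1 / 2) * I * (z + 2 * Real.pi) =
    ((n : ℂ) + 1 / 2) * I * z + Real.pi * I + n * (2 * Real.pi * I) := by ring
  rw [this, exp_add, exp_add, exp_int_mul_two_pi_mul_I, exp_pi_mul_I]
  ring

lemma neg_one_zpow_neg (n : ℤ) : (-1 : ℂ) ^ (-n) = (-1) ^ n := by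
  rw [zpow_neg, ← inv_zpow]; norm_num

lemma TT_neg (k : ℕ) (r : ℝ) (z : ℂ) : TT k r (-z) = (-1) ^ (k + 1) * TT k r z := by
  unfold TT
  rw [mul_left_comm]
  congr 1
  rw [← tsum_mul_left]
  rw [← (Equiv.subLeft (-1 : ℤ)).tsum_eq (fun n => tt k r n (-z))]
  refine tsum_congr fun n => ?_
  unfold tt
  simp only [Equiv.subLeft_apply]
  have e : (((-1 - n : ℤ) : ℂ) + 1 / 2) = - ((n : ℂ) + 1 / 2) := by push_cast; ring
  rw [e, mul_neg, neg_pow, neg_sq, neg_mul, neg_mul, mul_neg, neg_mul, neg_neg, sub_eq_add_neg,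
    zpow_add₀ (by norm_num), neg_one_zpow_neg n]
  rw [zpow_neg, zpow_one]
  ring

lemma TT0_add_tau {r : ℝ} (z : ℂ) :
    TT 0 r (z + 2 * I * r) = - exp (r - I * z) * TT 0 r z := by
  unfold TT
  rw [mul_left_comm]
  congr 1
  rw [← tsum_mul_left]
  rw [← (Equiv.addRight (1 : ℤ)).tsum_eq (fun n => - exp (r - I * z) * tt 0 r n z)]
  refine tsum_congr fun n => ?_
  unfold tt
  simp only [Equiv.coe_addRight, pow_zero, one_mul]
  rw [zpow_add₀ (by norm_num), zpow_one]
  have : exp (-↑r * (↑n + 1 / 2) ^ 2) * exp ((↑n + 1 / 2) * I * (z + 2 * I * ↑r)) =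
    exp (r - I * z) * (exp (-↑r * (((n + 1 : ℤ) : ℂ) + 1 / 2) ^ 2) * exp ((((n + 1 : ℤ) : ℂ) + 1 / 2) * I * z)) := by
    rw [← exp_add, ← exp_add, ← exp_add]
    congr 1
    push_cast
    linear_combination (2 * r * (n + 1 / 2)) * I_sq
  rw [mul_assoc, this]
  ring

lemma TT_add_tau_succ {r : ℝ} (hr : 0 < r) (k : ℕ) (A : ℂ → ℂ) (A' : ℂ → ℂ)
    (hA : ∀ z, HasDerivAt A (A' z) z)
    (h : ∀ z, TT k r (z + 2 * I * r) = exp (r - I * z) * A z) (z : ℂ) :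
    TT (k + 1) r (z + 2 * I * r) = exp (r - I * z) * (A' z - I * A z) := by
  have h1 : HasDerivAt (fun z => TT k r (z + 2 * I * r)) (TT (k + 1) r (z + 2 * I * r)) z :=
    (hasDerivAt_TT k hr _).comp_add_const z _
  have h2 : HasDerivAt (fun z : ℂ => (r : ℂ) - I * z) (- I) z := by
    simpa using ((hasDerivAt_id z).const_mul I).const_sub (r : ℂ)
  have h3 := h2.cexp.mul (hA z)
  rw [funext h] at h1
  rw [h1.unique h3]
  ring

lemma TT_tau {r : ℝ} (hr : 0 < r) (z : ℂ) :
    TT 0 r (z + 2 * I * r) = exp (r - I * z) * (- TT 0 r z) ∧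
    TT 1 r (z + 2 * I * r) = exp (r - I * z) * (- TT 1 r z + I * TT 0 r z) ∧
    TT 2 r (z + 2 * I * r) = exp (r - I * z) * (- TT 2 r z + 2 * I * TT 1 r z + TT 0 r z) ∧
    TT 3 r (z + 2 * I * r) = exp (r - I * z) *
      (- TT 3 r z + 3 * I * TT 2 r z + 3 * TT 1 r z - I * TT 0 r z) ∧
    TT 4 r (z + 2 * I * r) = exp (r - I * z) *
      (- TT 4 r z + 4 * I * TT 3 r z + 6 * TT 2 r z - 4 * I * TT 1 r z - TT 0 r z) := by
  have d := fun k z => hasDerivAt_TT k hr z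
  have t0 : ∀ z, TT 0 r (z + 2 * I * r) = exp (r - I * z) * (- TT 0 r z) := fun z => by
    rw [TT0_add_tau]; ring
  have t1 := TT_add_tau_succ hr 0 _ _ (fun z => (d 0 z).neg) t0
  have t2 := TT_add_tau_succ hr 1 _ _ (fun z => ((d 1 z).neg).sub (((d 0 z).neg).const_mul I)) t1
  have t3 := TT_add_tau_succ hr 2 _ _ (fun z => (((d 2 z).neg).sub (((d 1 z).neg).const_mul I)).sub
    ((((d 1 z).neg).sub (((d 0 z).neg).const_mul I)).const_mul I)) t2
  have t4 := TT_add_tau_succ hr 3 _ _ (fun z => ((((d 3 z).neg).sub (((d 2 z).neg).const_mul I)).sub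
    ((((d 2 z).neg).sub (((d 1 z).neg).const_mul I)).const_mul I)).sub (((((d 2 z).neg).sub (((d 1 z).neg).const_mul I)).sub
    ((((d 1 z).neg).sub (((d 0 z).neg).const_mul I)).const_mul I)).const_mul I)) t3
  have I3 : I ^ 3 = - I := by rw [pow_succ, I_sq]; ring
  have I4 : I ^ 4 = 1 := by rw [show 4 = 2 * 2 from rfl, pow_mul, I_sq]; ring
  refine ⟨t0 z, ?_, ?_, ?_, ?_⟩
  · rw [t1 z]; simp
  · rw [t2 z]; simp; ring_nf; simp only [I_sq]; ring
  · rw [t3 z]; simp; ring_nf; simp only [I_sq, I3, I4]; ring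
  · rw [t4 z]; simp; ring_nf; simp only [I_sq, I3, I4]; ring

lemma conj_tt (k : ℕ) (r : ℝ) (n : ℤ) (x : ℝ) :
    (starRingEnd ℂ) (tt k r n x) = - tt k r (-1 - n) x := by
  unfold tt
  have e : (((-1 - n : ℤ) : ℂ) + 1 / 2) = - ((n : ℂ) + 1 / 2) := by push_cast; ring
  rw [e, neg_sq, sub_eq_add_neg, zpow_add₀ (by norm_num), neg_one_zpow_neg n]
  have e2 : (starRingEnd ℂ) ((n : ℂ) + 1 / 2) = (n : ℂ) + 1 / 2 := by
    rw [show (n : ℂ) + 1 / 2 = ((n + 1 / 2 : ℝ) : ℂ) by push_cast; rfl, conj_ofReal]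
  simp only [map_mul, map_pow, map_zpow₀, ← exp_conj, map_neg, e2, conj_I, conj_ofReal, map_one]
  simp only [neg_mul, mul_neg, neg_neg, zpow_neg, zpow_one]
  norm_num

lemma TT_im (k : ℕ) (r : ℝ) (x : ℝ) : (TT k r x).im = 0 := by
  rw [← conj_eq_iff_im]
  unfold TT
  rw [map_mul, conj_tsum, ← (Equiv.subLeft (-1 : ℤ)).tsum_eq]
  simp only [Equiv.subLeft_apply, conj_tt]
  rw [tsum_neg]
  simp

lemma TT0_pi_ne {r : ℝ} (hr : 0 < r) : TT 0 r Real.pi ≠ 0 := by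
  have key : ∀ n : ℤ, tt 0 r n Real.pi = I * ((Real.exp (- r * (n + 1 / 2) ^ 2) : ℝ) : ℂ) := by
    intro n
    unfold tt
    have : ((n : ℂ) + 1 / 2) * I * Real.pi = n * (Real.pi * I) + Real.pi / 2 * I := by ring
    rw [this, exp_add, exp_int_mul, exp_pi_mul_I, exp_pi_div_two_mul_I]
    have h1 : (-1 : ℂ) ^ n * (-1) ^ n = 1 := by
      rw [← mul_zpow]; norm_num
    push_cast
    linear_combination (exp (-↑r * (↑n + 1 / 2) ^ 2) * I) * h1
  have hs := summable_tt 0 hr Real.pi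
  simp only [key] at hs
  have hs' : Summable fun n : ℤ => Real.exp (- r * (n + 1 / 2) ^ 2) := by
    have := (summable_mul_left_iff I_ne_zero).1 hs
    exact_mod_cast this
  unfold TT
  simp only [key]
  rw [tsum_mul_left, ← mul_assoc, one_div, inv_mul_cancel₀ I_ne_zero, one_mul, ← ofReal_tsum]
  exact_mod_cast (hs'.tsum_pos (fun i => (Real.exp_pos _).le) 0 (Real.exp_pos _)).ne'

structure IsV (r : ℝ) (f : ℂ → ℂ) : Prop where
  diff : Differentiable ℂ f
  per : ∀ z, f (z + 2 * Real.pi) = f z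
  tau : ∀ z, f (z + 2 * I * r) = exp (2 * r - 2 * I * z) * f z

lemma IsV.add {r : ℝ} {f g : ℂ → ℂ} (hf : IsV r f) (hg : IsV r g) :
    IsV r (fun z => f z + g z) :=
  ⟨hf.diff.add hg.diff, fun z => by rw [hf.per, hg.per], fun z => by rw [hf.tau, hg.tau]; ring⟩

lemma IsV.const_mul {r : ℝ} {f : ℂ → ℂ} (hf : IsV r f) (c : ℂ) :
    IsV r (fun z => c * f z) :=
  ⟨hf.diff.const_mul c, fun z => by rw [hf.per], fun z => by rw [hf.tau]; ring⟩

noncomputable def vcf (f : ℂ → ℂ) (n : ℤ) : ℂ :=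
  ∫ x in (0 : ℝ)..(2 * Real.pi), f x * exp (-(n * I * x))

lemma vcf_add {f g : ℂ → ℂ} (hf : Differentiable ℂ f) (hg : Differentiable ℂ g) (n : ℤ) :
    vcf (fun z => f z + g z) n = vcf f n + vcf g n := by
  unfold vcf
  have hf := hf.continuous
  have hg := hg.continuous
  rw [← intervalIntegral.integral_add]
  · congr 1; funext x; ring
  · apply Continuous.intervalIntegrable; fun_prop
  · apply Continuous.intervalIntegrable; fun_prop

lemma vcf_const_mul {f : ℂ → ℂ} (c : ℂ) (n : ℤ) :
    vcf (fun z => c * f z) n = c * vcf f n := by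
  unfold vcf
  rw [← intervalIntegral.integral_const_mul]
  congr 1; funext x; ring

lemma vcf_rec {r : ℝ} {f : ℂ → ℂ} (hf : IsV r f) (n : ℤ) :
    vcf f n = exp (2 * r * (n + 1)) * vcf f (n + 2) := by
  have hd := hf.diff
  have h := integral_boundary_rect_eq_zero_of_differentiableOn
    (fun z => f z * exp (-(n * I * z))) 0 (2 * Real.pi + 2 * I * r)
    (by fun_prop)
  have e1 : (2 * (Real.pi : ℂ) + 2 * I * r).re = 2 * Real.pi := by simp
  have e2 : (2 * (Real.pi : ℂ) + 2 * I * r).im = 2 * r := by simp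
  rw [e1, e2] at h
  have e3 : ∀ y : ℝ, f (((2 * Real.pi : ℝ) : ℂ) + y * I) *
      exp (-(n * I * (((2 * Real.pi : ℝ) : ℂ) + y * I))) =
      f (((0 : ℂ).re : ℂ) + y * I) * exp (-(n * I * (((0 : ℂ).re : ℂ) + y * I))) := by
    intro y
    have a1 : f (((2 * Real.pi : ℝ) : ℂ) + y * I) = f (y * I) := by
      rw [← hf.per (y * I)]; congr 1; push_cast; ring
    have a2 : -(n * I * (((2 * Real.pi : ℝ) : ℂ) + y * I)) = -(n * I * (y * I)) +
      ((-n : ℤ) : ℂ) * (2 * Real.pi * I) := by push_cast; ring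
    rw [a1, a2, exp_add, exp_int_mul_two_pi_mul_I]
    simp
  simp only [e3] at h
  have e4 : ∀ x : ℝ, f (x + (2 * r : ℝ) * I) * exp (-(n * I * (x + (2 * r : ℝ) * I))) =
      exp (2 * r * (n + 1)) * (f x * exp (-(((n + 2 : ℤ) : ℂ) * I * x))) := by
    intro x
    have a1 : f (x + (2 * r : ℝ) * I) = exp (2 * r - 2 * I * x) * f x := by
      rw [← hf.tau]; congr 1; push_cast; ring
    have a2 : exp (2 * r - 2 * I * x) * exp (-(n * I * (x + (2 * r : ℝ) * I))) =
      exp (2 * r * (n + 1)) * exp (-(((n + 2 : ℤ) : ℂ) * I * x)) := by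
      rw [← exp_add, ← exp_add]
      congr 1
      push_cast
      linear_combination (- (n : ℂ) * 2 * r) * I_sq
    rw [a1]
    linear_combination f x * a2
  simp only [e4] at h
  rw [intervalIntegral.integral_const_mul] at h
  unfold vcf
  simp at h
  simp
  linear_combination h

lemma vcf_zero {r : ℝ} {f : ℂ → ℂ} (hf : IsV r f) (h0 : vcf f 0 = 0) (h1 : vcf f 1 = 0) (n : ℤ) :
    vcf f n = 0 := by
  have up : ∀ n, vcf f n = 0 → vcf f (n + 2) = 0 := fun n h => by
    have := vcf_rec hf n
    rw [h] at this
    exact (mul_eq_zero.1 this.symm).resolve_left (exp_ne_zero _)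
  have down : ∀ n, vcf f (n + 2) = 0 → vcf f n = 0 := fun n h => by
    rw [vcf_rec hf n, h, mul_zero]
  have key : ∀ n : ℤ, vcf f n = 0 ∧ vcf f (n + 1) = 0 := by
    intro n
    induction n using Int.induction_on with
    | zero => exact ⟨h0, by simpa using h1⟩
    | succ i ih => exact ⟨ih.2, by have := up _ ih.1; rwa [add_assoc]⟩
    | pred i ih => exact ⟨down _ (by convert ih.2 using 2; ring), by simpa using ih.1⟩
  exact (key n).1

lemma IsV.eq_zero {r : ℝ} {f : ℂ → ℂ} (hf : IsV r f) (h0 : vcf f 0 = 0) (h1 : vcf f 1 = 0)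
    (z : ℂ) : f z = 0 := by
  have hc := vcf_zero hf h0 h1
  have : Fact (0 < 2 * Real.pi) := ⟨by positivity⟩
  have hper : Function.Periodic (fun x : ℝ => f x) (2 * Real.pi) := fun x => by
    have := hf.per x
    simpa using this
  let F : C(AddCircle (2 * Real.pi), ℂ) := ⟨hper.lift, by
    refine continuous_coinduced_dom.2 ?_
    have : Continuous fun x : ℝ => f x := hf.diff.continuous.comp continuous_ofReal
    exact this⟩
  have hF : ∀ n, fourierCoeff F n = 0 := by
    intro n
    rw [fourierCoeff_eq_intervalIntegral _ n 0]
    have : (∫ x in (0 : ℝ)..0 + 2 * Real.pi, fourier (-n) (x : AddCircle (2 * Real.pi)) • F x)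
      = vcf f n := by
      rw [zero_add]
      unfold vcf
      congr 1
      funext x
      rw [fourier_coe_apply]
      have : F (x : AddCircle (2 * Real.pi)) = f x := rfl
      rw [this, smul_eq_mul, mul_comm]
      congr 2
      have := Real.pi_ne_zero
      push_cast
      field_simp
    rw [this, hc, smul_zero]
  have hreal : ∀ x : ℝ, f x = 0 := by
    intro x
    have hs : Summable (fourierCoeff F) := by
      rw [funext hF]; exact summable_zero
    have := has_pointwise_sum_fourier_series_of_summable hs (x : AddCircle (2 * Real.pi))
    simp only [hF, zero_smul] at this
    exact this.unique hasSum_zero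
  have ha : AnalyticOnNhd ℂ f Set.univ := fun z _ => hf.diff.analyticAt z
  have := ha.eq_of_frequently_eq (g := fun _ => 0) (z₀ := 0) (fun z _ => analyticAt_const) ?_
  · rw [this]
  · have ht : Filter.Tendsto (fun x : ℝ => (x : ℂ)) (nhdsWithin 0 {0}ᶜ) (nhdsWithin 0 {0}ᶜ) := by
      refine tendsto_nhdsWithin_iff.2 ⟨?_, ?_⟩
      · exact (continuous_ofReal.tendsto' 0 0 (by simp)).mono_left nhdsWithin_le_nhds
      · filter_upwards [self_mem_nhdsWithin] with x hx
        simpa using hx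
    exact ht.frequently (Filter.Eventually.frequently (Filter.Eventually.of_forall hreal))

lemma IsV.eq_of_vcf {r : ℝ} {f g : ℂ → ℂ} (hf : IsV r f) (hg : IsV r g)
    (h0 : vcf f 0 = vcf g 0) (h1 : vcf f 1 = vcf g 1) (z : ℂ) : f z = g z := by
  have hv := hf.add (hg.const_mul (-1))
  have hd : ∀ n, vcf (fun z => f z + -1 * g z) n = vcf f n - vcf g n := fun n => by
    rw [vcf_add hf.diff (hg.const_mul (-1)).diff, vcf_const_mul]; ring
  have := hv.eq_zero (by rw [hd, h0, sub_self]) (by rw [hd, h1, sub_self]) z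
  linear_combination this

lemma IsV.dep {r : ℝ} {f g h : ℂ → ℂ} (hf : IsV r f) (hg : IsV r g) (hh : IsV r h)
    (f0 : f 0 = 0) (g0 : g 0 = 0) (h0 : h 0 ≠ 0) (hgne : ∃ z, g z ≠ 0) :
    ∃ k : ℂ, ∀ z, f z = k * g z := by
  have hD : vcf f 0 * vcf g 1 - vcf f 1 * vcf g 0 = 0 := by
    by_contra hD
    set D := vcf f 0 * vcf g 1 - vcf f 1 * vcf g 0 with hDdef
    let p := (vcf h 0 * vcf g 1 - vcf h 1 * vcf g 0) / D
    let q := (vcf f 0 * vcf h 1 - vcf f 1 * vcf h 0) / D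
    have hcomb : ∀ n, vcf (fun z => p * f z + q * g z) n = p * vcf f n + q * vcf g n := fun n => by
      rw [vcf_add (hf.const_mul p).diff (hg.const_mul q).diff, vcf_const_mul, vcf_const_mul]
    have := hh.eq_of_vcf ((hf.const_mul p).add (hg.const_mul q))
      (by rw [hcomb]; simp only [p, q]; field_simp; rw [hDdef]; ring)
      (by rw [hcomb]; simp only [p, q]; field_simp; rw [hDdef]; ring) 0
    rw [f0, g0] at this
    exact h0 (by simpa using this)
  by_cases hG0 : vcf g 0 = 0
  · by_cases hG1 : vcf g 1 = 0
    · obtain ⟨z, hz⟩ := hgne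
      exact absurd (hg.eq_zero hG0 hG1 z) hz
    · refine ⟨vcf f 1 / vcf g 1, hf.eq_of_vcf (hg.const_mul _) ?_ ?_⟩
      · rw [vcf_const_mul]; field_simp; linear_combination hD
      · rw [vcf_const_mul]; field_simp
  · refine ⟨vcf f 0 / vcf g 0, hf.eq_of_vcf (hg.const_mul _) ?_ ?_⟩
    · rw [vcf_const_mul]; field_simp
    · rw [vcf_const_mul]; field_simp; linear_combination -hD

open Filter Topology in
/-- Solutions of the quadratic equation have no zeros. -/
lemma no_zero {u u1 u2 a : ℂ → ℂ} {z₀ : ℂ} (h1 : ∀ z, HasDerivAt u (u1 z) z)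
    (h2 : ∀ z, HasDerivAt u1 (u2 z) z) (hne : ∃ z, u z ≠ 0) (ha : ContinuousAt a z₀)
    (h : ∀ᶠ z in 𝓝 z₀, u z * u2 z - u1 z ^ 2 = a z * u z ^ 2) : u z₀ ≠ 0 := by
  have hd : Differentiable ℂ u := fun z => (h1 z).differentiableAt
  have hn : ¬∀ᶠ z in 𝓝 z₀, u z = 0 := by
    intro hev
    have ha : AnalyticOnNhd ℂ u Set.univ := fun z _ => hd.analyticAt z
    have := ha.eq_of_eventuallyEq (g := fun _ => 0) (z₀ := z₀) (fun z _ => analyticAt_const) hev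
    obtain ⟨z, hz⟩ := hne
    exact hz (by rw [this])
  obtain ⟨m, g, hg, hg0, hev⟩ := (hd.analyticAt z₀).exists_eventuallyEq_pow_smul_nonzero_iff.2 hn
  have hgd : ∀ᶠ z in 𝓝 z₀, HasDerivAt g (deriv g z) z :=
    hg.eventually_analyticAt.mono fun z hz => hz.differentiableAt.hasDerivAt
  have hgd2 : ∀ᶠ z in 𝓝 z₀, HasDerivAt (deriv g) (deriv (deriv g) z) z :=
    hg.deriv.eventually_analyticAt.mono fun z hz => hz.differentiableAt.hasDerivAt
  have hw : ∀ z : ℂ, HasDerivAt (fun z : ℂ => z - z₀) 1 z := fun z => (hasDerivAt_id z).sub_const z₀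
  have e1 : ∀ᶠ z in 𝓝 z₀, (z - z₀) * u1 z =
      (z - z₀) ^ m * (m * g z + (z - z₀) * deriv g z) := by
    filter_upwards [hev.eventually_nhds, hgd] with z hz hgz
    have hh : HasDerivAt u _ z := HasDerivAt.congr_of_eventuallyEq (((hw z).pow m).mul hgz) hz
    rw [(h1 z).unique hh]
    rcases m with _ | m
    · simp
    · simp; ring
  have e2 : ∀ᶠ z in 𝓝 z₀, (z - z₀) ^ 2 * u2 z =
      (z - z₀) ^ m * (m * (m - 1) * g z + 2 * m * (z - z₀) * deriv g z
        + (z - z₀) ^ 2 * deriv (deriv g) z) := by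
    filter_upwards [e1.eventually_nhds, e1, hgd, hgd2] with z hz hz1 hgz hgz2
    have hh1 := (hw z).mul (h2 z)
    have hh2 := ((hw z).pow m).mul ((hgz.const_mul (m : ℂ)).add ((hw z).mul hgz2))
    have := (hh1.congr_of_eventuallyEq (EventuallyEq.symm hz)).unique hh2
    simp only [Pi.mul_apply, Pi.pow_apply, Pi.add_apply] at this
    have e3 : (z - z₀) * (↑m * (z - z₀) ^ (m - 1)) = m * (z - z₀) ^ m := by
      rcases m with _ | m
      · simp
      · simp; ring
    linear_combination (z - z₀) * this - hz1 + (↑m * g z + (z - z₀) * deriv g z) * e3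
  have e3 : ∀ᶠ z in 𝓝[≠] z₀, -(m : ℂ) * g z ^ 2 + (z - z₀) ^ 2 *
      (g z * deriv (deriv g) z - deriv g z ^ 2 - a z * g z ^ 2) = 0 := by
    filter_upwards [e1.filter_mono nhdsWithin_le_nhds, e2.filter_mono nhdsWithin_le_nhds,
      h.filter_mono nhdsWithin_le_nhds, hev.filter_mono nhdsWithin_le_nhds,
      self_mem_nhdsWithin] with z h1 h2 h3 h4 h5
    have hz : z - z₀ ≠ 0 := sub_ne_zero.2 h5
    rw [smul_eq_mul] at h4
    have hp : ((z - z₀) ^ m) ^ 2 ≠ 0 := pow_ne_zero _ (pow_ne_zero _ hz)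
    refine (mul_eq_zero.1 ?_).resolve_left hp
    rw [h4] at h3
    linear_combination (z - z₀) ^ 2 * h3 - (z - z₀) ^ m * g z * h2 +
      ((z - z₀) * u1 z + (z - z₀) ^ m * (m * g z + (z - z₀) * deriv g z)) * h1
  have hlim : Tendsto (fun z => -(m : ℂ) * g z ^ 2 + (z - z₀) ^ 2 *
      (g z * deriv (deriv g) z - deriv g z ^ 2 - a z * g z ^ 2)) (𝓝[≠] z₀)
      (𝓝 (-(m : ℂ) * g z₀ ^ 2 + (z₀ - z₀) ^ 2 *
      (g z₀ * deriv (deriv g) z₀ - deriv g z₀ ^ 2 - a z₀ * g z₀ ^ 2))) := by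
    have c1 := hg.continuousAt
    have c2 := hg.deriv.continuousAt
    have c3 := hg.deriv.deriv.continuousAt
    have : ContinuousAt (fun z => -(m : ℂ) * g z ^ 2 + (z - z₀) ^ 2 *
      (g z * deriv (deriv g) z - deriv g z ^ 2 - a z * g z ^ 2)) z₀ := by fun_prop
    exact this.tendsto.mono_left nhdsWithin_le_nhds
  have hz := tendsto_nhds_unique hlim (tendsto_const_nhds.congr' (e3.mono fun z hz => hz.symm))
  have hm : (m : ℂ) = 0 := by
    have : (m : ℂ) * g z₀ ^ 2 = 0 := by linear_combination -hz
    exact (mul_eq_zero.1 this).resolve_right (pow_ne_zero _ hg0)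
  have hm' : m = 0 := by exact_mod_cast hm
  have := hev.self_of_nhds
  rw [this, hm']
  simpa using hg0

lemma isV_sq {r : ℝ} (hr : 0 < r) : IsV r (fun z => TT 0 r z ^ 2) := by
  have d := fun k z => (hasDerivAt_TT k hr z).differentiableAt
  refine ⟨fun z => (d 0 z).pow 2, fun z => by rw [TT_add_two_pi, neg_sq], fun z => ?_⟩
  obtain ⟨h0, -⟩ := TT_tau hr z
  rw [h0, mul_pow, neg_sq, ← exp_nat_mul]
  congr 2; push_cast; ring

lemma exp_sq_aux (r : ℝ) (z : ℂ) : exp (2 * r - 2 * I * z) = exp (r - I * z) ^ 2 := by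
  rw [← exp_nat_mul]; congr 1; push_cast; ring

lemma isV_shift {r : ℝ} (hr : 0 < r) : IsV r (fun z => TT 0 r (z + Real.pi) ^ 2) := by
  have hv := isV_sq hr
  refine ⟨hv.diff.comp (differentiable_id.add_const _), fun z => ?_, fun z => ?_⟩
  · have := hv.per (z + Real.pi)
    rw [← this]; congr 2; ring
  · have := hv.tau (z + Real.pi)
    have e : exp (2 * r - 2 * I * (z + Real.pi)) = exp (2 * r - 2 * I * z) := by
      rw [show 2 * r - 2 * I * (z + Real.pi) = 2 * r - 2 * I * z - 2 * Real.pi * I by ring,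
        exp_periodic.sub_eq]
    rw [← e, ← this]; congr 2; ring

lemma isV_W {r : ℝ} (hr : 0 < r) : IsV r (fun z => TT 0 r z * TT 2 r z - TT 1 r z ^ 2) := by
  have d := fun k z => (hasDerivAt_TT k hr z).differentiableAt
  refine ⟨fun z => ((d 0 z).mul (d 2 z)).sub ((d 1 z).pow 2), fun z => ?_, fun z => ?_⟩
  · simp only [TT_add_two_pi]; ring
  · obtain ⟨h0, h1, h2, -⟩ := TT_tau hr z
    rw [h0, h1, h2, exp_sq_aux]
    linear_combination (- exp (r - I * z) ^ 2 * TT 0 r z ^ 2) * I_sq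

lemma isV_D {r : ℝ} (hr : 0 < r) :
    IsV r (fun z => TT 0 r z * TT 4 r z - 4 * (TT 1 r z * TT 3 r z) + 3 * TT 2 r z ^ 2) := by
  have d := fun k z => (hasDerivAt_TT k hr z).differentiableAt
  refine ⟨fun z => (((d 0 z).mul (d 4 z)).sub (((d 1 z).mul (d 3 z)).const_mul 4)).add
    (((d 2 z).pow 2).const_mul 3), fun z => ?_, fun z => ?_⟩
  · simp only [TT_add_two_pi]; ring
  · obtain ⟨h0, h1, h2, h3, h4⟩ := TT_tau hr z
    rw [h0, h1, h2, h3, h4, exp_sq_aux]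
    linear_combination (exp (r - I * z) ^ 2 * (12 * TT 1 r z ^ 2 - 12 * TT 0 r z * TT 2 r z + 4 * TT 0 r z ^ 2)) * I_sq

lemma TT_even_zero {k : ℕ} (hk : Even k) (r : ℝ) : TT k r 0 = 0 := by
  have := TT_neg k r 0
  rw [neg_zero, pow_succ, hk.neg_one_pow] at this
  linear_combination this / 2

lemma TT0_zero (r : ℝ) : TT 0 r 0 = 0 := TT_even_zero (by decide) r
lemma TT2_zero (r : ℝ) : TT 2 r 0 = 0 := TT_even_zero (by decide) r
lemma TT4_zero (r : ℝ) : TT 4 r 0 = 0 := TT_even_zero (by decide) r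

lemma TT1_pi (r : ℝ) : TT 1 r Real.pi = 0 := by
  have h1 := TT_neg 1 r Real.pi
  have h2 := TT_add_two_pi 1 r (-Real.pi)
  rw [show -(Real.pi : ℂ) + 2 * Real.pi = Real.pi by ring] at h2
  linear_combination h2 / 2 - h1 / 2

lemma V_dep {r : ℝ} (hr : 0 < r) {f : ℂ → ℂ} (hf : IsV r f) (f0 : f 0 = 0) :
    ∃ k : ℂ, ∀ z, f z = k * TT 0 r z ^ 2 :=
  hf.dep (isV_sq hr) (isV_shift hr) f0 (by simp [TT0_zero])
    (by simpa using TT0_pi_ne hr) ⟨Real.pi, pow_ne_zero _ (TT0_pi_ne hr)⟩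

lemma TT1_ne {r : ℝ} (hr : 0 < r) : TT 1 r 0 ≠ 0 := by
  intro h
  obtain ⟨k, hk⟩ := V_dep hr (isV_W hr) (by simp [TT0_zero, h])
  exact no_zero (u := TT 0 r) (a := fun _ => k) (hasDerivAt_TT 0 hr) (hasDerivAt_TT 1 hr)
    ⟨_, TT0_pi_ne hr⟩ continuousAt_const (Filter.Eventually.of_forall hk) (TT0_zero r)

lemma hirota {r : ℝ} (hr : 0 < r) (z : ℂ) :
    TT 0 r z * TT 4 r z - 4 * (TT 1 r z * TT 3 r z) + 3 * TT 2 r z ^ 2 +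
      12 * (- TT 3 r 0 / (3 * TT 1 r 0)) * (TT 0 r z * TT 2 r z - TT 1 r z ^ 2) =
    (TT 3 r 0 ^ 2 - TT 1 r 0 * TT 5 r 0) / TT 1 r 0 ^ 2 * TT 0 r z ^ 2 := by
  have ht := TT1_ne hr
  set c := - TT 3 r 0 / (3 * TT 1 r 0) with hc
  obtain ⟨k, hk⟩ := V_dep hr ((isV_D hr).add ((isV_W hr).const_mul (12 * c))) (by
    simp only [TT0_zero, TT2_zero, TT4_zero, hc]; field_simp; ring)
  have d := fun k z => hasDerivAt_TT k hr z
  have D1 : ∀ z, TT 0 r z * TT 5 r z - 3 * (TT 1 r z * TT 4 r z) + 2 * (TT 2 r z * TT 3 r z) +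
      12 * c * (TT 0 r z * TT 3 r z - TT 1 r z * TT 2 r z) = k * (2 * (TT 0 r z * TT 1 r z)) := by
    intro z
    have h1 := ((((d 0 z).fun_mul (d 4 z)).fun_sub (((d 1 z).fun_mul (d 3 z)).const_mul 4)).fun_add
      (((d 2 z).fun_pow 2).const_mul 3)).fun_add ((((d 0 z).fun_mul (d 2 z)).fun_sub ((d 1 z).fun_pow 2)).const_mul (12 * c))
    have h2 := ((d 0 z).fun_pow 2).const_mul k
    rw [← funext hk] at h2
    have := h1.unique h2
    norm_num at this
    linear_combination this
  have h1 := ((((d 0 0).fun_mul (d 5 0)).fun_sub (((d 1 0).fun_mul (d 4 0)).const_mul 3)).fun_add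
      (((d 2 0).fun_mul (d 3 0)).const_mul 2)).fun_add ((((d 0 0).fun_mul (d 3 0)).fun_sub ((d 1 0).fun_mul (d 2 0))).const_mul (12 * c))
  have h2 := (((d 0 0).fun_mul (d 1 0)).const_mul 2).const_mul k
  rw [← funext D1] at h2
  have := h1.unique h2
  norm_num [TT0_zero, TT2_zero, TT4_zero] at this
  have hkk : k = (TT 3 r 0 ^ 2 - TT 1 r 0 * TT 5 r 0) / TT 1 r 0 ^ 2 := by
    field_simp
    linear_combination - this / 2
  rw [← hkk, ← hk z]

/-- The period pair. -/
noncomputable def LL (r : ℝ) (hr : 0 < r) : PeriodPair where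
  ω₁ := 2 * Real.pi
  ω₂ := 2 * I * r
  indep := by
    rw [LinearIndependent.pair_iff]
    intro s t h
    have h1 := congrArg Complex.re h
    have h2 := congrArg Complex.im h
    simp at h1 h2
    exact ⟨h1, h2.resolve_right hr.ne'⟩

lemma mem_LL {r : ℝ} {hr : 0 < r} {x : ℂ} :
    x ∈ (LL r hr).lattice ↔ ∃ m n : ℤ, m * (2 * Real.pi : ℂ) + n * (2 * I * r) = x :=
  PeriodPair.mem_lattice

lemma real_mem_LL {r : ℝ} {hr : 0 < r} {x : ℝ} (h : (x : ℂ) ∈ (LL r hr).lattice) (h0 : 0 ≤ x)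
    (h1 : x < 2 * Real.pi) : x = 0 := by
  obtain ⟨m, n, h⟩ := mem_LL.1 h
  have h3 := congrArg Complex.re h
  simp at h3
  have hpi := Real.pi_pos
  have hm : m = 0 := by
    have a1 : (m : ℝ) < 1 := by
      by_contra hh; push Not at hh; nlinarith
    have a2 : (-1 : ℝ) < m := by
      by_contra hh; push Not at hh; nlinarith
    have a1' : m < 1 := by exact_mod_cast a1
    have a2' : -1 < m := by exact_mod_cast a2
    omega
  rw [hm] at h3
  simpa using h3.symm

lemma TT0_mem {r : ℝ} (hr : 0 < r) {x : ℂ} (h : x ∈ (LL r hr).lattice) : TT 0 r x = 0 := by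
  have p1 : Function.Periodic (fun x => TT 0 r x = 0) (2 * Real.pi : ℂ) := fun z => by
    simp only [TT_add_two_pi, neg_eq_zero]
  have p2 : Function.Periodic (fun x => TT 0 r x = 0) (2 * I * r : ℂ) := fun z => by
    simp only [(TT_tau hr z).1, mul_eq_zero, exp_ne_zero, false_or, neg_eq_zero]
  obtain ⟨m, n, rfl⟩ := mem_LL.1 h
  have := (p2.int_mul n (m * (2 * Real.pi : ℂ))).trans ((p1.int_mul m).eq)
  rw [this]
  exact TT0_zero r

open PeriodPair in
open Classical in
noncomputable def QQ (r : ℝ) (hr : 0 < r) (z : ℂ) : ℂ :=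
  if z ∈ (LL r hr).lattice then TT 1 r z ^ 2 else (LL r hr).weierstrassP z * TT 0 r z ^ 2

lemma QQ_diff {r : ℝ} (hr : 0 < r) : Differentiable ℂ (QQ r hr) := by
  intro z
  have d := fun k z => (hasDerivAt_TT k hr z).differentiableAt
  by_cases hz : z ∈ (LL r hr).lattice
  · have hloc : QQ r hr =ᶠ[nhds z] fun w =>
        ((LL r hr).weierstrassPExcept z w - 1 / z ^ 2) * TT 0 r w ^ 2 + (dslope (TT 0 r) z w) ^ 2 := by
      filter_upwards [(LL r hr).compl_lattice_sdiff_singleton_mem_nhds z] with w hw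
      unfold QQ
      by_cases hwz : w = z
      · subst hwz
        rw [if_pos hz, dslope_same, TT0_mem hr hz, (hasDerivAt_TT 0 hr w).deriv]
        simp
      · have : w ∉ (LL r hr).lattice := fun h => hw ⟨h, hwz⟩
        have h := (LL r hr).weierstrassPExcept_add ⟨z, hz⟩ w
        rw [if_neg this, dslope_of_ne _ hwz, slope_def_field, TT0_mem hr hz, ← h]
        have : w - z ≠ 0 := sub_ne_zero.2 hwz
        field_simp
        ring
    refine DifferentiableAt.congr_of_eventuallyEq ?_ hloc
    have h1 : DifferentiableAt ℂ ((LL r hr).weierstrassPExcept z) z :=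
      ((LL r hr).differentiableOn_weierstrassPExcept z).differentiableAt
        ((LL r hr).compl_lattice_sdiff_singleton_mem_nhds z)
    have h2 : DifferentiableAt ℂ (dslope (TT 0 r) z) z := by
      have : DifferentiableOn ℂ (dslope (TT 0 r) z) Set.univ :=
        (Complex.differentiableOn_dslope Filter.univ_mem).2 (fun w _ => (d 0 w).differentiableWithinAt)
      exact this.differentiableAt Filter.univ_mem
    exact ((h1.sub_const _).mul ((d 0 z).pow 2)).add (h2.pow 2)
  · have ho : ((LL r hr).lattice : Set ℂ)ᶜ ∈ nhds z := (LL r hr).isClosed_lattice.isOpen_compl.mem_nhds hz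
    have hloc : QQ r hr =ᶠ[nhds z] fun w => (LL r hr).weierstrassP w * TT 0 r w ^ 2 := by
      filter_upwards [ho] with w hw
      unfold QQ
      rw [if_neg (show w ∉ (LL r hr).lattice from hw)]
    refine DifferentiableAt.congr_of_eventuallyEq ?_ hloc
    exact ((LL r hr).differentiableOn_weierstrassP.differentiableAt ho).mul ((d 0 z).pow 2)

lemma isV_Q {r : ℝ} (hr : 0 < r) : IsV r (QQ r hr) := by
  have m1 : (2 * Real.pi : ℂ) ∈ (LL r hr).lattice := (LL r hr).ω₁_mem_lattice
  have m2 : (2 * I * r : ℂ) ∈ (LL r hr).lattice := (LL r hr).ω₂_mem_lattice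
  refine ⟨QQ_diff hr, fun z => ?_, fun z => ?_⟩
  · have := (LL r hr).weierstrassP_add_coe z ⟨_, m1⟩
    simp only at this
    unfold QQ
    rw [Submodule.add_mem_iff_left _ m1, this, TT_add_two_pi, TT_add_two_pi, neg_sq, neg_sq]
  · have := (LL r hr).weierstrassP_add_coe z ⟨_, m2⟩
    simp only at this
    obtain ⟨h0, h1, -⟩ := TT_tau hr z
    unfold QQ
    rw [Submodule.add_mem_iff_left _ m2, this, h0, h1, exp_sq_aux]
    split_ifs with h
    · rw [TT0_mem hr h]; ring
    · ring

/-- the Weierstrass identity, with unidentified constant -/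
lemma wp_identity {r : ℝ} (hr : 0 < r) : ∃ k : ℂ, ∀ z, z ∉ (LL r hr).lattice →
    TT 0 r z * TT 2 r z - TT 1 r z ^ 2 = (k - (LL r hr).weierstrassP z) * TT 0 r z ^ 2 := by
  obtain ⟨k, hk⟩ := V_dep hr ((isV_W hr).add (isV_Q hr)) (by
    simp [QQ, TT0_zero])
  refine ⟨k, fun z hz => ?_⟩
  have := hk z
  simp only [QQ, if_neg hz] at this
  linear_combination this

lemma TT0_ne {r : ℝ} (hr : 0 < r) {z : ℂ} (hz : z ∉ (LL r hr).lattice) : TT 0 r z ≠ 0 := by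
  obtain ⟨k, hk⟩ := wp_identity hr
  have ho : ((LL r hr).lattice : Set ℂ)ᶜ ∈ nhds z := (LL r hr).isClosed_lattice.isOpen_compl.mem_nhds hz
  refine no_zero (u := TT 0 r) (a := fun z => k - (LL r hr).weierstrassP z) (hasDerivAt_TT 0 hr)
    (hasDerivAt_TT 1 hr) ⟨_, TT0_pi_ne hr⟩ ?_ ?_
  · exact continuousAt_const.sub ((LL r hr).differentiableOn_weierstrassP.differentiableAt ho).continuousAt
  · filter_upwards [ho] with w hw using hk w hw

lemma TT0_real_ne {r : ℝ} (hr : 0 < r) {x : ℝ} (h0 : 0 < x) (h1 : x < 2 * Real.pi) :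
    TT 0 r x ≠ 0 :=
  TT0_ne hr fun h => h0.ne' (real_mem_LL h h0.le h1)

/-- Θ(z)/z as an entire function -/
noncomputable def SS (r : ℝ) : ℂ → ℂ := dslope (TT 0 r) 0

lemma SS_diff {r : ℝ} (hr : 0 < r) : Differentiable ℂ (SS r) := by
  have : DifferentiableOn ℂ (SS r) Set.univ :=
    (Complex.differentiableOn_dslope Filter.univ_mem).2
      (fun w _ => (hasDerivAt_TT 0 hr w).differentiableAt.differentiableWithinAt)
  exact fun z => this.differentiableAt Filter.univ_mem

lemma entire_deriv {f : ℂ → ℂ} (hf : Differentiable ℂ f) : Differentiable ℂ (deriv f) := fun _ =>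
  ((hf.differentiableOn (s := Set.univ)).deriv isOpen_univ).differentiableAt Filter.univ_mem

lemma TT0_SS (r : ℝ) (z : ℂ) : TT 0 r z = z * SS r z := by
  have := sub_smul_dslope (TT 0 r) 0 z
  unfold SS
  simpa [TT0_zero] using this.symm

lemma TT1_SS {r : ℝ} (hr : 0 < r) (z : ℂ) : TT 1 r z = SS r z + z * deriv (SS r) z := by
  have h1 := hasDerivAt_TT 0 hr z
  rw [funext (TT0_SS r)] at h1
  have h2 := (hasDerivAt_id z).fun_mul (SS_diff hr z).hasDerivAt
  have := h1.unique h2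
  simpa using this

lemma TT2_SS {r : ℝ} (hr : 0 < r) (z : ℂ) :
    TT 2 r z = 2 * deriv (SS r) z + z * deriv (deriv (SS r)) z := by
  have h1 := hasDerivAt_TT 1 hr z
  rw [funext (TT1_SS hr)] at h1
  have h2 := (SS_diff hr z).hasDerivAt.fun_add ((hasDerivAt_id z).fun_mul (entire_deriv (SS_diff hr) z).hasDerivAt)
  have := h1.unique h2
  simp at this
  linear_combination this

lemma TT3_SS {r : ℝ} (hr : 0 < r) (z : ℂ) :
    TT 3 r z = 3 * deriv (deriv (SS r)) z + z * deriv (deriv (deriv (SS r))) z := by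
  have h1 := hasDerivAt_TT 2 hr z
  rw [funext (TT2_SS hr)] at h1
  have e1 := entire_deriv (SS_diff hr)
  have h2 := ((e1 z).hasDerivAt.const_mul 2).fun_add ((hasDerivAt_id z).fun_mul (entire_deriv e1 z).hasDerivAt)
  have := h1.unique h2
  simp at this
  linear_combination this

lemma SS_zero {r : ℝ} (hr : 0 < r) : SS r 0 = TT 1 r 0 := by
  have := TT1_SS hr 0
  simpa using this.symm

lemma SS_ne {r : ℝ} (hr : 0 < r) {z : ℂ} (hz : z = 0 ∨ z ∉ (LL r hr).lattice) : SS r z ≠ 0 := by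
  rcases hz with rfl | hz
  · rw [SS_zero hr]; exact TT1_ne hr
  · intro h
    exact TT0_ne hr hz (by rw [TT0_SS, h, mul_zero])

lemma SS_identity {r : ℝ} (hr : 0 < r) {z : ℂ} (hz : z = 0 ∨ z ∉ (LL r hr).lattice) :
    SS r z * deriv (deriv (SS r)) z - deriv (SS r) z ^ 2 =
      (TT 3 r 0 / (3 * TT 1 r 0) - (LL r hr).weierstrassPExcept 0 z) * SS r z ^ 2 := by
  obtain ⟨k, hk⟩ := wp_identity hr
  have key : ∀ z, z ∉ (LL r hr).lattice → SS r z * deriv (deriv (SS r)) z - deriv (SS r) z ^ 2 =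
      (k - (LL r hr).weierstrassPExcept 0 z) * SS r z ^ 2 := by
    intro z hz
    have h1 := hk z hz
    have h2 := (LL r hr).weierstrassPExcept_add ⟨0, zero_mem _⟩ z
    have hz0 : z ≠ 0 := by rintro rfl; exact hz (zero_mem _)
    simp only [sub_zero] at h2
    rw [← h2, TT0_SS, TT1_SS hr, TT2_SS hr] at h1
    field_simp at h1
    simp at h1
    have : z ^ 2 ≠ 0 := pow_ne_zero _ hz0
    apply mul_left_cancel₀ this
    linear_combination h1
  have e1 := entire_deriv (SS_diff hr)
  have e2 := entire_deriv e1
  have c1 : ContinuousAt (fun z => SS r z * deriv (deriv (SS r)) z - deriv (SS r) z ^ 2) 0 :=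
    (((SS_diff hr).continuous.mul e2.continuous).sub (e1.continuous.pow 2)).continuousAt
  have hm := (LL r hr).compl_lattice_sdiff_singleton_mem_nhds 0
  have cP : ContinuousAt ((LL r hr).weierstrassPExcept 0) 0 :=
    (((LL r hr).differentiableOn_weierstrassPExcept 0).differentiableAt hm).continuousAt
  have c2 : ContinuousAt (fun z => (k - (LL r hr).weierstrassPExcept 0 z) * SS r z ^ 2) 0 :=
    (continuousAt_const.sub cP).mul ((SS_diff hr).continuous.continuousAt.pow 2)
  have h0 := (((c1.eventuallyEq_nhds_iff_eventuallyEq_nhdsNE c2).1) (by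
    rw [Filter.EventuallyEq, eventually_nhdsWithin_iff]
    filter_upwards [hm] with w hw hw0
    exact key w fun h => hw ⟨h, hw0⟩)).self_of_nhds
  have hkk : k = TT 3 r 0 / (3 * TT 1 r 0) := by
    have a2 := TT2_SS hr 0
    have a3 := TT3_SS hr 0
    have ht := TT1_ne hr
    simp [TT2_zero, SS_zero hr, (LL r hr).weierstrassPExcept_zero] at a2 a3 h0
    rw [a2] at h0
    rw [eq_div_iff (by simpa using ht), a3]
    apply mul_left_cancel₀ ht
    linear_combination -3 * h0
  rcases hz with rfl | hz
  · rw [← hkk]; exact h0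
  · rw [← hkk]; exact key z hz

lemma real_ok {r : ℝ} (hr : 0 < r) {x : ℝ} (h : x ∈ Set.Icc 0 Real.pi) :
    (x : ℂ) = 0 ∨ (x : ℂ) ∉ (LL r hr).lattice := by
  by_cases hx : x = 0
  · left; simp [hx]
  · right
    intro hm
    exact hx (real_mem_LL hm h.1 (by linarith [h.2, Real.pi_pos]))

lemma P0_cont {r : ℝ} (hr : 0 < r) :
    ContinuousOn (fun x : ℝ => (LL r hr).weierstrassPExcept 0 x) (Set.Icc 0 Real.pi) := by
  refine ((LL r hr).differentiableOn_weierstrassPExcept 0).continuousOn.comp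
    continuous_ofReal.continuousOn fun x hx => ?_
  rintro ⟨h1, h2⟩
  exact (real_ok hr hx).elim (fun h => h2 h) (fun h => h h1)

lemma P0_integral {r : ℝ} (hr : 0 < r) :
    ∫ x in (0:ℝ)..Real.pi, (LL r hr).weierstrassPExcept 0 x =
      Real.pi * (TT 3 r 0 / (3 * TT 1 r 0)) + 1 / Real.pi := by
  have hpi := Real.pi_pos
  have e1 := entire_deriv (SS_diff hr)
  have hc : IntervalIntegrable (fun x : ℝ => (LL r hr).weierstrassPExcept 0 x) MeasureTheory.volume 0 Real.pi :=
    ContinuousOn.intervalIntegrable (by rw [Set.uIcc_of_le hpi.le]; exact P0_cont hr)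
  have := intervalIntegral.integral_eq_sub_of_hasDerivAt (a := 0) (b := Real.pi)
    (f := fun x : ℝ => deriv (SS r) x / SS r x)
    (f' := fun x : ℝ => TT 3 r 0 / (3 * TT 1 r 0) - (LL r hr).weierstrassPExcept 0 x) (by
      intro x hx
      rw [Set.uIcc_of_le hpi.le] at hx
      have ok := real_ok hr hx
      have h := ((e1 x).hasDerivAt.fun_div (SS_diff hr x).hasDerivAt (SS_ne hr ok)).comp_ofReal
      refine h.congr_deriv (Eq.symm ?_)
      rw [eq_div_iff (pow_ne_zero _ (SS_ne hr ok)), ← SS_identity hr ok]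
      ring) ((intervalIntegrable_const).sub hc)
  rw [intervalIntegral.integral_sub intervalIntegrable_const hc, intervalIntegral.integral_const] at this
  have a0 := TT2_SS hr 0
  have a1 := TT1_SS hr Real.pi
  have hS : SS r Real.pi ≠ 0 := SS_ne hr (real_ok hr ⟨hpi.le, le_rfl⟩)
  have hpc : (Real.pi : ℂ) ≠ 0 := by exact_mod_cast hpi.ne'
  simp [TT2_zero] at a0
  rw [TT1_pi] at a1
  have hq : deriv (SS r) Real.pi / SS r Real.pi = - (1 / Real.pi) := by
    field_simp
    linear_combination -a1
  rw [hq] at this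
  simp [a0] at this
  simp
  linear_combination - this

lemma term_integral {r : ℝ} (hr : 0 < r) {l : ℂ} (hl : l ∈ (LL r hr).lattice) (l0 : l ≠ 0) :
    ∫ x in (0:ℝ)..Real.pi, (1 / ((x:ℂ) - l) ^ 2 - 1 / l ^ 2) =
      - (1 / (Real.pi - l) + 1 / l + Real.pi / l ^ 2) := by
  have hpi := Real.pi_pos
  have hne : ∀ x ∈ Set.uIcc 0 Real.pi, (x : ℂ) - l ≠ 0 := by
    intro x hx h
    rw [Set.uIcc_of_le hpi.le] at hx
    have e := sub_eq_zero.1 h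
    rcases real_ok hr hx with h1 | h1
    · exact l0 (by rw [← e, h1])
    · exact h1 (e ▸ hl)
  have := intervalIntegral.integral_eq_sub_of_hasDerivAt (a := 0) (b := Real.pi)
    (f := fun x : ℝ => - (1 / ((x:ℂ) - l)) - x / l ^ 2)
    (f' := fun x : ℝ => 1 / ((x:ℂ) - l) ^ 2 - 1 / l ^ 2) (by
      intro x hx
      have h1 := ((((hasDerivAt_id (x:ℂ)).sub_const l).fun_inv (hne x hx)).neg.sub
        ((hasDerivAt_id (x:ℂ)).div_const (l ^ 2))).comp_ofReal
      simpa [neg_div] using h1) (by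
      apply ContinuousOn.intervalIntegrable
      apply ContinuousOn.sub _ continuousOn_const
      apply ContinuousOn.div continuousOn_const (by fun_prop)
      intro x hx
      exact pow_ne_zero _ (hne x hx))
  rw [this]
  have := hne Real.pi (by simp)
  simp
  ring

lemma term_cont {r : ℝ} (hr : 0 < r) (l : (LL r hr).lattice) :
    ContinuousOn (fun x : ℝ => if l.1 = 0 then (0:ℂ) else (1 / ((x:ℂ) - l.1) ^ 2 - 1 / l.1 ^ 2))
      (Set.Icc 0 Real.pi) := by
  split_ifs with l0
  · exact continuousOn_const
  apply ContinuousOn.sub _ continuousOn_const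
  apply ContinuousOn.div continuousOn_const (by fun_prop)
  intro x hx h
  have e := sub_eq_zero.1 (pow_eq_zero_iff (two_ne_zero) |>.1 h)
  rcases real_ok hr hx with h1 | h1
  · exact l0 (by rw [← e, h1])
  · exact h1 (e ▸ l.2)

lemma hasSum_terms {r : ℝ} (hr : 0 < r) :
    HasSum (fun l : (LL r hr).lattice => if l.1 = 0 then (0:ℂ) else
      - (1 / (Real.pi - l.1) + 1 / l.1 + Real.pi / l.1 ^ 2))
      (∫ x in (0:ℝ)..Real.pi, (LL r hr).weierstrassPExcept 0 x) := by
  have hpi := Real.pi_pos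
  have : Countable (LL r hr).lattice := (LL r hr).latticeEquivProd.toEquiv.countable_iff.2 inferInstance
  have h1 := hasSumLocallyUniformly_iff_tendstoLocallyUniformly.1
    ((LL r hr).hasSumLocallyUniformly_weierstrassPExcept 0)
  have h2 : TendstoLocallyUniformly (fun (s : Finset (LL r hr).lattice) (x : ℝ) =>
      ∑ l ∈ s, if l.1 = 0 then (0:ℂ) else (1 / ((x:ℂ) - l.1) ^ 2 - 1 / l.1 ^ 2))
      (fun x : ℝ => (LL r hr).weierstrassPExcept 0 x) Filter.atTop := by
    exact h1.comp _ continuous_ofReal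
  have h3 := ((tendstoLocallyUniformlyOn_iff_tendstoUniformlyOn_of_compact
    (isCompact_uIcc (a := 0) (b := Real.pi))).1 h2.tendstoLocallyUniformlyOn)
  have hcont : ∀ l : (LL r hr).lattice, ContinuousOn (fun x : ℝ => if l.1 = 0 then (0:ℂ) else (1 / ((x:ℂ) - l.1) ^ 2 - 1 / l.1 ^ 2)) (Set.uIcc 0 Real.pi) := by
    intro l; rw [Set.uIcc_of_le hpi.le]; exact term_cont hr l
  have h4 := h3.tendsto_intervalIntegral_of_continuousOn (μ := MeasureTheory.volume)
    (Filter.Eventually.of_forall fun s => continuousOn_finsetSum s fun l _ => hcont l)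
  refine Filter.Tendsto.congr (fun s => ?_) h4
  rw [intervalIntegral.integral_finsetSum fun l _ => (hcont l).intervalIntegrable]
  refine Finset.sum_congr rfl fun l _ => ?_
  beta_reduce
  split_ifs with l0
  · simp
  · exact term_integral hr l.2 l0

lemma wzeta_pi {r : ℝ} (hr : 0 < r) :
    wzeta r Real.pi = Real.pi * (- TT 3 r 0 / (3 * TT 1 r 0)) := by
  have h := ((LL r hr).latticeEquivProd.symm.toEquiv.hasSum_iff).2 (hasSum_terms hr)
  have h' : HasSum (fun p : ℤ × ℤ => if p = 0 then (0:ℂ) else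
    (1 / ((Real.pi : ℂ) - latPt r p) + 1 / latPt r p + Real.pi / latPt r p ^ 2))
      (-∫ x in (0:ℝ)..Real.pi, (LL r hr).weierstrassPExcept 0 x) := by
    have hn := h.neg
    refine (congrArg (fun f => HasSum f _) (funext fun p => ?_)).mpr hn
    have e : ((LL r hr).latticeEquivProd.symm p).1 = latPt r p := by
      rw [PeriodPair.latticeEquiv_symm_apply]
      show (p.1 : ℂ) * (2 * Real.pi) + p.2 * (2 * I * r) = _
      unfold latPt; ring
    have e0 : latPt r p = 0 ↔ p = 0 := by
      rw [← e]; simp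
    simp only [Function.comp, LinearEquiv.coe_toEquiv, e, e0]
    split_ifs <;> simp
  unfold wzeta
  rw [h'.tsum_eq, P0_integral hr]
  ring

/-- complex ratio of derivatives of theta -/
noncomputable def AC (k : ℕ) (r : ℝ) (z : ℂ) : ℂ := TT k r z / TT 0 r z

/-- real theta derivatives on the real axis -/
noncomputable def tR (k : ℕ) (r x : ℝ) : ℝ := (TT k r x).re

/-- real ratios -/
noncomputable def AR (k : ℕ) (r x : ℝ) : ℝ := tR k r x / tR 0 r x

lemma TT_eq_tR (k : ℕ) (r x : ℝ) : TT k r x = (tR k r x : ℂ) := by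
  apply Complex.ext <;> simp [tR, TT_im]

lemma AC_eq_AR (k : ℕ) (r x : ℝ) : AC k r x = (AR k r x : ℂ) := by
  simp [AC, AR, TT_eq_tR]

lemma hasDerivAt_AC (k : ℕ) {r : ℝ} (hr : 0 < r) {z : ℂ} (hz : TT 0 r z ≠ 0) :
    HasDerivAt (AC k r) (AC (k+1) r z - AC 1 r z * AC k r z) z := by
  refine ((hasDerivAt_TT k hr z).div (hasDerivAt_TT 0 hr z) hz).congr_deriv ?_
  unfold AC
  field_simp

lemma Hker_eq {r : ℝ} (hr : 0 < r) (z : ℂ) : Hker r z = 2 * AC 1 r z := by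
  unfold Hker AC
  rw [← TT_zero, (hasDerivAt_TT 0 hr z).deriv]
  ring

lemma deriv_Hker {r : ℝ} (hr : 0 < r) {z : ℂ} (hz : TT 0 r z ≠ 0) :
    deriv (Hker r) z = 2 * (AC 2 r z - AC 1 r z ^ 2) := by
  rw [funext (Hker_eq hr), ((hasDerivAt_AC 1 hr hz).const_mul 2).deriv]
  ring

lemma deriv2_Hker {r : ℝ} (hr : 0 < r) {z : ℂ} (hz : TT 0 r z ≠ 0) :
    deriv (deriv (Hker r)) z = 2 * (AC 3 r z - 3 * AC 1 r z * AC 2 r z + 2 * AC 1 r z ^ 3) := by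
  have h : deriv (Hker r) =ᶠ[nhds z] fun w => 2 * (AC 2 r w - AC 1 r w ^ 2) := by
    filter_upwards [(hasDerivAt_TT 0 hr z).continuousAt.eventually_ne hz] with w hw using deriv_Hker hr hw
  rw [h.deriv_eq, (((hasDerivAt_AC 2 hr hz).fun_sub ((hasDerivAt_AC 1 hr hz).fun_pow 2)).const_mul 2).deriv]
  norm_num
  ring

lemma tR0_ne {r : ℝ} (hr : 0 < r) {x : ℝ} (hx : x ∈ Set.Ioo 0 (2 * Real.pi)) : tR 0 r x ≠ 0 := by
  have := TT0_real_ne hr hx.1 hx.2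
  rw [TT_eq_tR] at this
  exact_mod_cast this

lemma tR1_ne {r : ℝ} (hr : 0 < r) : tR 1 r 0 ≠ 0 := by
  have := TT1_ne hr
  rw [show (0:ℂ) = ((0:ℝ):ℂ) by simp, TT_eq_tR] at this
  exact_mod_cast this

lemma tR_dx (k : ℕ) {r : ℝ} (hr : 0 < r) (x : ℝ) :
    HasDerivAt (fun y => tR k r y) (tR (k+1) r x) x :=
  (hasDerivAt_TT k hr x).real_of_complex

lemma tR_ds (k : ℕ) {r : ℝ} (hr : 0 < r) (x : ℝ) :
    HasDerivAt (fun s => tR k s x) (tR (k+2) r x) r :=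
  Complex.reCLM.hasFDerivAt.comp_hasDerivAt r (hasDerivAt_TT_r k hr x)

lemma AR_dx (k : ℕ) {r : ℝ} (hr : 0 < r) {x : ℝ} (hx : x ∈ Set.Ioo 0 (2 * Real.pi)) :
    HasDerivAt (fun y => AR k r y) (AR (k+1) r x - AR 1 r x * AR k r x) x := by
  have h0 := tR0_ne hr hx
  refine ((tR_dx k hr x).fun_div (tR_dx 0 hr x) h0).congr_deriv ?_
  unfold AR
  field_simp

lemma AR_ds (k : ℕ) {r : ℝ} (hr : 0 < r) {x : ℝ} (hx : x ∈ Set.Ioo 0 (2 * Real.pi)) :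
    HasDerivAt (fun s => AR k s x) (AR (k+2) r x - AR 2 r x * AR k r x) r := by
  have h0 := tR0_ne hr hx
  refine ((tR_ds k hr x).fun_div (tR_ds 0 hr x) h0).congr_deriv ?_
  unfold AR
  field_simp

/-- H and its first x-derivatives in terms of the ratios -/
noncomputable def h0 (r x : ℝ) : ℝ := 2 * AR 1 r x
noncomputable def h1 (r x : ℝ) : ℝ := 2 * (AR 2 r x - AR 1 r x ^ 2)
noncomputable def h2 (r x : ℝ) : ℝ := 2 * (AR 3 r x - 3 * AR 1 r x * AR 2 r x + 2 * AR 1 r x ^ 3)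
noncomputable def h3 (r x : ℝ) : ℝ := 2 * (AR 4 r x - 4 * AR 1 r x * AR 3 r x - 3 * AR 2 r x ^ 2 +
  12 * AR 1 r x ^ 2 * AR 2 r x - 6 * AR 1 r x ^ 4)
noncomputable def h4 (r x : ℝ) : ℝ := 2 * (AR 5 r x - 5 * AR 1 r x * AR 4 r x
  - 10 * AR 2 r x * AR 3 r x + 20 * AR 1 r x ^ 2 * AR 3 r x + 30 * AR 1 r x * AR 2 r x ^ 2
  - 60 * AR 1 r x ^ 3 * AR 2 r x + 24 * AR 1 r x ^ 5)
/-- the constant ζ(π)/π -/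
noncomputable def cc (r : ℝ) : ℝ := - tR 3 r 0 / (3 * tR 1 r 0)
/-- its r-derivative -/
noncomputable def ee (r : ℝ) : ℝ := (tR 3 r 0 ^ 2 - tR 1 r 0 * tR 5 r 0) / (3 * tR 1 r 0 ^ 2)

section
variable {r x : ℝ}

lemma h0_dx (hr : 0 < r) (hx : x ∈ Set.Ioo 0 (2 * Real.pi)) :
    HasDerivAt (fun y => h0 r y) (h1 r x) x := by
  refine ((AR_dx 1 hr hx).const_mul 2).congr_deriv ?_
  unfold h1; norm_num; ring

lemma h1_dx (hr : 0 < r) (hx : x ∈ Set.Ioo 0 (2 * Real.pi)) :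
    HasDerivAt (fun y => h1 r y) (h2 r x) x := by
  refine (((AR_dx 2 hr hx).fun_sub ((AR_dx 1 hr hx).fun_pow 2)).const_mul 2).congr_deriv ?_
  unfold h2; norm_num; ring

lemma h2_dx (hr : 0 < r) (hx : x ∈ Set.Ioo 0 (2 * Real.pi)) :
    HasDerivAt (fun y => h2 r y) (h3 r x) x := by
  have a1 := AR_dx 1 hr hx
  have a2 := AR_dx 2 hr hx
  have a3 := AR_dx 3 hr hx
  refine (((a3.fun_sub ((a1.const_mul 3).fun_mul a2)).fun_add
    ((a1.fun_pow 3).const_mul 2)).const_mul 2).congr_deriv ?_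
  unfold h3; norm_num; ring

lemma h3_dx (hr : 0 < r) (hx : x ∈ Set.Ioo 0 (2 * Real.pi)) :
    HasDerivAt (fun y => h3 r y) (h4 r x) x := by
  have a1 := AR_dx 1 hr hx
  have a2 := AR_dx 2 hr hx
  have a3 := AR_dx 3 hr hx
  have a4 := AR_dx 4 hr hx
  refine (((((a4.fun_sub ((a1.const_mul 4).fun_mul a3)).fun_sub ((a2.fun_pow 2).const_mul 3)).fun_add
    (((a1.fun_pow 2).const_mul 12).fun_mul a2)).fun_sub
    ((a1.fun_pow 4).const_mul 6)).const_mul 2).congr_deriv ?_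
  unfold h4; norm_num; ring

lemma h0_ds (hr : 0 < r) (hx : x ∈ Set.Ioo 0 (2 * Real.pi)) :
    HasDerivAt (fun s => h0 s x) (h2 r x + h0 r x * h1 r x) r := by
  refine ((AR_ds 1 hr hx).const_mul 2).congr_deriv ?_
  unfold h0 h1 h2; norm_num; ring

lemma h1_ds (hr : 0 < r) (hx : x ∈ Set.Ioo 0 (2 * Real.pi)) :
    HasDerivAt (fun s => h1 s x) (h3 r x + h1 r x ^ 2 + h0 r x * h2 r x) r := by
  refine (((AR_ds 2 hr hx).fun_sub ((AR_ds 1 hr hx).fun_pow 2)).const_mul 2).congr_deriv ?_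
  unfold h0 h1 h2 h3; norm_num; ring

lemma h2_ds (hr : 0 < r) (hx : x ∈ Set.Ioo 0 (2 * Real.pi)) :
    HasDerivAt (fun s => h2 s x) (h4 r x + 3 * h1 r x * h2 r x + h0 r x * h3 r x) r := by
  have a1 := AR_ds 1 hr hx
  have a2 := AR_ds 2 hr hx
  have a3 := AR_ds 3 hr hx
  refine (((a3.fun_sub ((a1.const_mul 3).fun_mul a2)).fun_add
    ((a1.fun_pow 3).const_mul 2)).const_mul 2).congr_deriv ?_
  unfold h0 h1 h2 h3 h4; norm_num; ring

lemma cc_ds (hr : 0 < r) : HasDerivAt cc (ee r) r := by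
  have ht := tR1_ne hr
  refine ((tR_ds 3 hr 0).fun_neg.fun_div ((tR_ds 1 hr 0).const_mul 3) (by simpa using ht)).congr_deriv ?_
  unfold ee; norm_num; field_simp; ring

lemma h3_eq (hr : 0 < r) (hx : x ∈ Set.Ioo 0 (2 * Real.pi)) :
    h3 r x = -3 * h1 r x ^ 2 - 12 * cc r * h1 r x + 6 * ee r := by
  have h := hirota hr x
  rw [show (0:ℂ) = ((0:ℝ):ℂ) by simp] at h
  simp only [TT_eq_tR] at h
  norm_cast at h
  have hn := tR0_ne hr hx
  have ht := tR1_ne hr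
  have e1 : cc r = - tR 3 r 0 / (3 * tR 1 r 0) := rfl
  have e2 : (tR 3 r 0 ^ 2 - tR 1 r 0 * tR 5 r 0) / tR 1 r 0 ^ 2 = 3 * ee r := by
    unfold ee; field_simp
  rw [e2, ← e1] at h
  unfold h3 h1 AR
  field_simp
  linear_combination 2 * tR 0 r x ^ 2 * h

lemma h4_eq (hr : 0 < r) (hx : x ∈ Set.Ioo 0 (2 * Real.pi)) :
    h4 r x = -6 * h1 r x * h2 r x - 12 * cc r * h2 r x := by
  have d1 := h1_dx hr hx
  have h : (fun y => h3 r y) =ᶠ[nhds x] fun y => -3 * h1 r y ^ 2 - 12 * cc r * h1 r y + 6 * ee r := by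
    filter_upwards [isOpen_Ioo.mem_nhds hx] with y hy using h3_eq hr hy
  have := ((h3_dx hr hx).congr_of_eventuallyEq h.symm).unique
    ((((d1.fun_pow 2).const_mul (-3)).fun_sub (d1.const_mul (12 * cc r))).add_const (6 * ee r))
  rw [this]; norm_num; ring

/-- prefactor -/
noncomputable def gg (r x : ℝ) : ℝ := tR 1 r 0 ^ 2 / tR 0 r x ^ 2
/-- bracket -/
noncomputable def FF (r x : ℝ) : ℝ :=
  4 * h0 r x ^ 3 - 6 * h0 r x * h1 r x + h2 r x + 12 * cc r * h0 r x

lemma wz_eq (hr : 0 < r) : (wzeta r (Real.pi : ℂ)).re / Real.pi = cc r := by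
  rw [wzeta_pi hr, show (0:ℂ) = ((0:ℝ):ℂ) by simp]
  simp only [TT_eq_tR]
  have : (Real.pi : ℂ) * (-(tR 3 r 0 : ℂ) / (3 * (tR 1 r 0 : ℂ))) = ((Real.pi * cc r : ℝ) : ℂ) := by
    unfold cc; push_cast; ring
  rw [this, ofReal_re]
  field_simp [Real.pi_ne_zero]

lemma H0_eq (hr : 0 < r) : (Hker r (x : ℂ)).re = h0 r x := by
  rw [Hker_eq hr, AC_eq_AR, h0]
  norm_cast

lemma H1_eq (hr : 0 < r) (hx : x ∈ Set.Ioo 0 (2 * Real.pi)) :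
    (deriv (Hker r) (x : ℂ)).re = h1 r x := by
  rw [deriv_Hker hr (TT0_real_ne hr hx.1 hx.2), h1]
  simp only [AC_eq_AR]
  norm_cast

lemma H2_eq (hr : 0 < r) (hx : x ∈ Set.Ioo 0 (2 * Real.pi)) :
    (deriv (deriv (Hker r)) (x : ℂ)).re = h2 r x := by
  rw [deriv2_Hker hr (TT0_real_ne hr hx.1 hx.2), h2]
  simp only [AC_eq_AR]
  norm_cast

lemma Zone_eq (hr : 0 < r) (hx : x ∈ Set.Ioo 0 (2 * Real.pi)) : Zone r x = gg r x * FF r x := by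
  unfold Zone
  rw [wz_eq hr, H0_eq hr, H1_eq hr hx, H2_eq hr hx, ← TT_zero, (hasDerivAt_TT 0 hr 0).deriv]
  unfold gg FF tR
  simp

lemma gg_dx (hr : 0 < r) (hx : x ∈ Set.Ioo 0 (2 * Real.pi)) :
    HasDerivAt (fun y => gg r y) (- h0 r x * gg r x) x := by
  have hn := tR0_ne hr hx
  refine (((hasDerivAt_const x (tR 1 r 0 ^ 2))).fun_div ((tR_dx 0 hr x).fun_pow 2)
    (pow_ne_zero 2 hn)).congr_deriv ?_
  unfold h0 gg AR; norm_num; field_simp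

lemma gg_ds (hr : 0 < r) (hx : x ∈ Set.Ioo 0 (2 * Real.pi)) :
    HasDerivAt (fun s => gg s x) ((-6 * cc r - h1 r x - h0 r x ^ 2 / 2) * gg r x) r := by
  have hn := tR0_ne hr hx
  have ht := tR1_ne hr
  refine (((tR_ds 1 hr 0).fun_pow 2).fun_div ((tR_ds 0 hr x).fun_pow 2)
    (pow_ne_zero 2 hn)).congr_deriv ?_
  unfold h0 h1 gg cc AR; norm_num; field_simp; ring

lemma FF_dx (hr : 0 < r) (hx : x ∈ Set.Ioo 0 (2 * Real.pi)) :
    HasDerivAt (fun y => FF r y)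
      (12 * h0 r x ^ 2 * h1 r x - 9 * h1 r x ^ 2 - 6 * h0 r x * h2 r x + 6 * ee r) x := by
  have a0 := h0_dx hr hx
  have a1 := h1_dx hr hx
  have a2 := h2_dx hr hx
  refine (((((a0.fun_pow 3).const_mul 4).fun_sub ((a0.const_mul 6).fun_mul a1)).fun_add a2).fun_add
    (a0.const_mul (12 * cc r))).congr_deriv ?_
  rw [h3_eq hr hx]; norm_num; ring

lemma FF_ds (hr : 0 < r) (hx : x ∈ Set.Ioo 0 (2 * Real.pi)) :
    HasDerivAt (fun s => FF s x)
      ((12 * h0 r x ^ 2 - 6 * h1 r x + 12 * cc r) * (h2 r x + h0 r x * h1 r x)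
        - 6 * h0 r x * (h3 r x + h1 r x ^ 2 + h0 r x * h2 r x)
        + (h4 r x + 3 * h1 r x * h2 r x + h0 r x * h3 r x) + 12 * ee r * h0 r x) r := by
  have a0 := h0_ds hr hx
  have a1 := h1_ds hr hx
  have a2 := h2_ds hr hx
  refine (((((a0.fun_pow 3).const_mul 4).fun_sub ((a0.const_mul 6).fun_mul a1)).fun_add a2).fun_add
    (((cc_ds hr).const_mul 12).fun_mul a0)).congr_deriv ?_
  norm_num; ring

lemma Zone_dx (hr : 0 < r) (hx : x ∈ Set.Ioo 0 (2 * Real.pi)) :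
    HasDerivAt (Zone r) (gg r x * (- h0 r x * FF r x +
      (12 * h0 r x ^ 2 * h1 r x - 9 * h1 r x ^ 2 - 6 * h0 r x * h2 r x + 6 * ee r))) x := by
  have h : Zone r =ᶠ[nhds x] fun y => gg r y * FF r y := by
    filter_upwards [isOpen_Ioo.mem_nhds hx] with y hy using Zone_eq hr hy
  refine (((gg_dx hr hx).fun_mul (FF_dx hr hx)).congr_of_eventuallyEq h).congr_deriv ?_
  ring

lemma Zone_dxx (hr : 0 < r) (hx : x ∈ Set.Ioo 0 (2 * Real.pi)) :
    HasDerivAt (fun y => deriv (Zone r) y) (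
      - h0 r x * gg r x * (- h0 r x * FF r x +
      (12 * h0 r x ^ 2 * h1 r x - 9 * h1 r x ^ 2 - 6 * h0 r x * h2 r x + 6 * ee r)) +
      gg r x * (- h1 r x * FF r x - h0 r x *
      (12 * h0 r x ^ 2 * h1 r x - 9 * h1 r x ^ 2 - 6 * h0 r x * h2 r x + 6 * ee r) +
      (24 * h0 r x * h1 r x ^ 2 + 12 * h0 r x ^ 2 * h2 r x - 24 * h1 r x * h2 r x
        - 6 * h0 r x * h3 r x))) x := by
  have a0 := h0_dx hr hx
  have a1 := h1_dx hr hx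
  have a2 := h2_dx hr hx
  have h : (fun y => deriv (Zone r) y) =ᶠ[nhds x] fun y => gg r y * (- h0 r y * FF r y +
      (12 * h0 r y ^ 2 * h1 r y - 9 * h1 r y ^ 2 - 6 * h0 r y * h2 r y + 6 * ee r)) := by
    filter_upwards [isOpen_Ioo.mem_nhds hx] with y hy using (Zone_dx hr hy).deriv
  refine (((gg_dx hr hx).fun_mul ((a0.fun_neg.fun_mul (FF_dx hr hx)).fun_add
    ((((((a0.fun_pow 2).const_mul 12).fun_mul a1).fun_sub ((a1.fun_pow 2).const_mul 9)).fun_sub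
    ((a0.const_mul 6).fun_mul a2)).add_const (6 * ee r)))).congr_of_eventuallyEq h).congr_deriv ?_
  push_cast; ring

lemma Zone_ds (hr : 0 < r) (hx : x ∈ Set.Ioo 0 (2 * Real.pi)) :
    HasDerivAt (fun s => Zone s x) (((-6 * cc r - h1 r x - h0 r x ^ 2 / 2) * gg r x) * FF r x +
      gg r x * ((12 * h0 r x ^ 2 - 6 * h1 r x + 12 * cc r) * (h2 r x + h0 r x * h1 r x)
        - 6 * h0 r x * (h3 r x + h1 r x ^ 2 + h0 r x * h2 r x)
        + (h4 r x + 3 * h1 r x * h2 r x + h0 r x * h3 r x) + 12 * ee r * h0 r x)) r := by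
  have h : (fun s => Zone s x) =ᶠ[nhds r] fun s => gg s x * FF s x := by
    filter_upwards [isOpen_Ioi.mem_nhds hr] with s hs using Zone_eq hs hx
  exact ((gg_ds hr hx).fun_mul (FF_ds hr hx)).congr_of_eventuallyEq h

end

/-- Null-vector equation for the explicit partition function at κ = 1. -/
theorem null_vector_kappa_one (r : ℝ) (hr : 0 < r)
    (x : ℝ) (hx : x ∈ Set.Ioo 0 (2 * Real.pi)) :
    deriv (fun s => Zone s x) r =
      1 / 2 * deriv (fun y => deriv (Zone r) y) x +
      (Hker r (x : ℂ)).re * deriv (Zone r) x +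
      5 / 2 * (deriv (Hker r) (x : ℂ)).re * Zone r x -
      6 * ((wzeta r (Real.pi : ℂ)).re / Real.pi) * Zone r x := by
  rw [(Zone_ds hr hx).deriv, (Zone_dxx hr hx).deriv, (Zone_dx hr hx).deriv, wz_eq hr, H0_eq hr,
    H1_eq hr hx, Zone_eq hr hx, h4_eq hr hx, h3_eq hr hx]
  unfold FF
  ring
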